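/- The number of alternating involutions of length 2n avoiding the pattern 1234 equals the n-th Motzkin number M_n. -/

import Mathlib

/-- A permutation is an involution if it equals its inverse. -/
def IsInvolution {n : ℕ} (π : Equiv.Perm (Fin n)) : Prop :=
  ∀ i, π (π i) = i

/-- `π` is alternating: `π i < π (i+1)` iff `i` is odd (1-based positions). -/
def IsAlternating {n : ℕ} (π : Equiv.Perm (Fin n)) : Prop :=
  ∀ (i : Fin n) (h : (i : ℕ) + 1 < n), (π i < π ⟨(i : ℕ) + 1, h⟩ ↔ Odd ((i : ℕ) + 1))

/-- `π` is reverse alternating: `π i > π (i+1)` iff `i` is odd (1-based positions). -/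
def IsRevAlternating {n : ℕ} (π : Equiv.Perm (Fin n)) : Prop :=
  ∀ (i : Fin n) (h : (i : ℕ) + 1 < n), (π ⟨(i : ℕ) + 1, h⟩ < π i ↔ Odd ((i : ℕ) + 1))

/-- `σ` contains the pattern `τ`. -/
def Contains {n k : ℕ} (σ : Equiv.Perm (Fin n)) (τ : Equiv.Perm (Fin k)) : Prop :=
  ∃ f : Fin k → Fin n, StrictMono f ∧ ∀ a b : Fin k, σ (f a) < σ (f b) ↔ τ a < τ b

/-- `σ` avoids the pattern `τ`. -/
def Avoids {n k : ℕ} (σ : Equiv.Perm (Fin n)) (τ : Equiv.Perm (Fin k)) : Prop :=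
  ¬ Contains σ τ
def p123 : Equiv.Perm (Fin 3) := ⟨![0,1,2], ![0,1,2], by decide, by decide⟩
def p132 : Equiv.Perm (Fin 3) := ⟨![0,2,1], ![0,2,1], by decide, by decide⟩
def p321 : Equiv.Perm (Fin 3) := ⟨![2,1,0], ![2,1,0], by decide, by decide⟩
def p1234 : Equiv.Perm (Fin 4) := ⟨![0,1,2,3], ![0,1,2,3], by decide, by decide⟩
def p4321 : Equiv.Perm (Fin 4) := ⟨![3,2,1,0], ![3,2,1,0], by decide, by decide⟩
def p3412 : Equiv.Perm (Fin 4) := ⟨![2,3,0,1], ![2,3,0,1], by decide, by decide⟩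
def p3421 : Equiv.Perm (Fin 4) := ⟨![2,3,1,0], ![3,2,0,1], by decide, by decide⟩
def p4312 : Equiv.Perm (Fin 4) := ⟨![3,2,0,1], ![2,3,1,0], by decide, by decide⟩
def p2431 : Equiv.Perm (Fin 4) := ⟨![1,3,2,0], ![3,0,2,1], by decide, by decide⟩
def p4132 : Equiv.Perm (Fin 4) := ⟨![3,0,2,1], ![1,3,2,0], by decide, by decide⟩

/-! ### Local growth rules (row labels) -/

def LocRule (h v h' v' : ℕ) (x : Prop) : Prop :=
  (x ∧ h = 0 ∧ v = 0 ∧ h' = 1 ∧ v' = 1) ∨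
  (¬ x ∧ h = v ∧ h ≠ 0 ∧ h' = h + 1 ∧ v' = h + 1) ∨
  (¬ x ∧ (h ≠ v ∨ (h = 0 ∧ v = 0)) ∧ h' = h ∧ v' = v)

theorem LocRule.symm {h v h' v' : ℕ} {x : Prop} (H : LocRule h v h' v' x) :
    LocRule v h v' h' x := by
  unfold LocRule at *
  rcases H with H | H | H
  · exact Or.inl ⟨H.1, by omega⟩
  · exact Or.inr (Or.inl ⟨H.1, by omega⟩)
  · exact Or.inr (Or.inr ⟨H.1, by omega⟩)

theorem LocRule.fwd {h v h' v' k' l' : ℕ} {x y : Prop} (H : LocRule h v h' v' x)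
    (K : LocRule h v k' l' y) (hxy : x ↔ y) : h' = k' ∧ v' = l' := by
  unfold LocRule at *; grind

theorem LocRule.bwd {h v k l h' v' : ℕ} {x y : Prop} (H : LocRule h v h' v' x)
    (K : LocRule k l h' v' y) : h = k ∧ v = l ∧ (x ↔ y) := by
  unfold LocRule at *; grind

theorem LocRule.cons {h v h' v' : ℕ} {x : Prop} (H : LocRule h v h' v' x) (r : ℕ) :
    (if h' = r then (1:ℤ) else 0) + (if v = r then 1 else 0)
      = (if h = r then 1 else 0) + (if v' = r then 1 else 0) := by
  unfold LocRule at *; grind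

def gscan (G : ℕ → ℕ → ℕ → ℕ × ℕ) (b : ℕ) (H : ℕ → ℕ) : ℕ → ℕ
  | 0 => b
  | i + 1 => (G i (H i) (gscan G b H i)).2

def grows (G : ℕ → ℕ → ℕ → ℕ → ℕ × ℕ) (bh bv : ℕ → ℕ) : ℕ → ℕ → ℕ
  | 0 => bh
  | j + 1 => fun i => (G j i (grows G bh bv j i) (gscan (G j) (bv j) (grows G bh bv j) i)).1

theorem exists_grid (G : ℕ → ℕ → ℕ → ℕ → ℕ × ℕ) (bh bv : ℕ → ℕ) :
    ∃ h v : ℕ → ℕ → ℕ, (∀ i, h i 0 = bh i) ∧ (∀ j, v 0 j = bv j) ∧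
      ∀ i j, (h i (j + 1), v (i + 1) j) = G j i (h i j) (v i j) :=
  ⟨fun i j => grows G bh bv j i, fun i j => gscan (G j) (bv j) (grows G bh bv j) i,
    fun _ => rfl, fun _ => rfl, fun _ _ => rfl⟩

def Loc (N : ℕ) (X : ℕ → ℕ → Prop) (h v : ℕ → ℕ → ℕ) : Prop :=
  ∀ i j, i < N → j < N → LocRule (h i j) (v i j) (h i (j + 1)) (v (i + 1) j) (X i j)

theorem Loc.transpose {N X h v} (H : Loc N X h v) :
    Loc N (fun i j => X j i) (fun i j => v j i) (fun i j => h j i) :=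
  fun i j hi hj => (H j i hj hi).symm

theorem Loc.fwd_unique {N X Y h v k l} (H : Loc N X h v) (K : Loc N Y k l)
    (hXY : ∀ i j, i < N → j < N → (X i j ↔ Y i j))
    (h0 : ∀ i, i < N → h i 0 = k i 0) (v0 : ∀ j, j < N → v 0 j = l 0 j) (m : ℕ) :
    ∀ i j, i ≤ N → j ≤ N → i + j ≤ m →
      (i < N → h i j = k i j) ∧ (j < N → v i j = l i j) := by
  induction m with
  | zero =>
    intro i j hi hj hm
    obtain rfl : i = 0 := by omega
    obtain rfl : j = 0 := by omega
    exact ⟨h0 0, v0 0⟩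
  | succ m ih =>
    intro i j hi hj hm
    constructor
    · intro hi'
      cases j with
      | zero => exact h0 i hi'
      | succ j =>
        have e := ih i j hi (by omega) (by omega)
        have := K i j hi' (by omega)
        rw [← e.1 hi', ← e.2 (by omega)] at this
        exact ((H i j hi' (by omega)).fwd this (hXY _ _ hi' (by omega))).1
    · intro hj'
      cases i with
      | zero => exact v0 j hj'
      | succ i =>
        have e := ih i j (by omega) hj (by omega)
        have := K i j (by omega) hj'
        rw [← e.1 (by omega), ← e.2 hj'] at this
        exact ((H i j (by omega) hj').fwd this (hXY _ _ (by omega) hj')).2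

theorem Loc.bwd_unique {N X Y h v k l} (H : Loc N X h v) (K : Loc N Y k l)
    (h0 : ∀ i, i < N → h i N = k i N) (v0 : ∀ j, j < N → v N j = l N j) (m : ℕ) :
    ∀ i j, i ≤ N → j ≤ N → (N - i) + (N - j) ≤ m →
      (i < N → h i j = k i j) ∧ (j < N → v i j = l i j) := by
  induction m with
  | zero =>
    intro i j hi hj hm
    constructor <;> intros <;> omega
  | succ m ih =>
    intro i j hi hj hm
    by_cases hiN : i = N
    · subst hiN; exact ⟨by omega, v0 j⟩
    by_cases hjN : j = N
    · subst hjN; exact ⟨h0 i, by omega⟩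
    have e1 := (ih i (j + 1) hi (by omega) (by omega)).1 (by omega)
    have e2 := (ih (i + 1) j (by omega) hj (by omega)).2 (by omega)
    have := K i j (by omega) (by omega)
    rw [← e1, ← e2] at this
    have := (H i j (by omega) (by omega)).bwd this
    exact ⟨fun _ => this.1, fun _ => this.2.1⟩

theorem Loc.bwd_X {N X Y h v k l} (H : Loc N X h v) (K : Loc N Y k l)
    (h0 : ∀ i, i < N → h i N = k i N) (v0 : ∀ j, j < N → v N j = l N j) :
    ∀ i j, i < N → j < N → (X i j ↔ Y i j) := by
  intro i j hi hj
  have u := fun m => H.bwd_unique K h0 v0 m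
  have e1 := (u _ i (j + 1) hi.le hj le_rfl).1 hi
  have e2 := (u _ (i + 1) j hi hj.le le_rfl).2 hj
  have := K i j hi hj
  rw [← e1, ← e2] at this
  exact ((H i j hi hj).bwd this).2.2

/-- prefix count -/
def pc (w : ℕ → ℕ) (r i : ℕ) : ℤ := ∑ k ∈ Finset.range i, if w k = r then 1 else 0

theorem pc_zero (w : ℕ → ℕ) (r : ℕ) : pc w r 0 = 0 := by simp [pc]

theorem pc_succ (w : ℕ → ℕ) (r i : ℕ) :
    pc w r (i + 1) = pc w r i + if w i = r then 1 else 0 := by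
  rw [pc, Finset.sum_range_succ, pc]

theorem pc_nonneg (w : ℕ → ℕ) (r i : ℕ) : 0 ≤ pc w r i :=
  Finset.sum_nonneg (fun _ _ => by split <;> simp)

theorem pc_congr {w w' : ℕ → ℕ} {r i : ℕ} (h : ∀ k < i, w k = w' k) : pc w r i = pc w' r i :=
  Finset.sum_congr rfl (fun k hk => by rw [h k (Finset.mem_range.1 hk)])

/-- A shape function compatible with the labels. -/
structure Shp (N : ℕ) (h v : ℕ → ℕ → ℕ) (s : ℕ → ℕ → ℕ → ℤ) : Prop where
  hh : ∀ r i j, i < N → j ≤ N → 1 ≤ r → s r (i + 1) j = s r i j + if h i j = r then 1 else 0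
  vv : ∀ r i j, i ≤ N → j < N → 1 ≤ r → s r i (j + 1) = s r i j + if v i j = r then 1 else 0

theorem Loc.shp_fwd {N X h v} (H : Loc N X h v) (v0 : ∀ j, j < N → v 0 j = 0) :
    Shp N h v (fun r i j => pc (fun k => h k j) r i) where
  hh r i j hi hj hr := by simp [pc_succ]
  vv r i j hi hj hr := by
    induction i with
    | zero => simp [pc_zero, v0 j hj]; omega
    | succ i ih =>
      have := ih (by omega)
      have c := (H i j (by omega) hj).cons r
      simp only [pc_succ] at *
      linarith

theorem Loc.part_fwd {N X h v s} (H : Loc N X h v) (S : Shp N h v s)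
    (h0 : ∀ r i, i ≤ N → 1 ≤ r → s (r + 1) i 0 ≤ s r i 0)
    (v0 : ∀ r j, j ≤ N → 1 ≤ r → s (r + 1) 0 j ≤ s r 0 j) :
    ∀ i j, i ≤ N → j ≤ N → ∀ r, 1 ≤ r → s (r + 1) i j ≤ s r i j := by
  intro i
  induction i with
  | zero => intro j hi hj r hr; exact v0 r j hj hr
  | succ i ihi =>
    intro j
    induction j with
    | zero => intro hi hj r hr; exact h0 r _ hi hr
    | succ j ihj =>
      intro hi hj r hr
      have l := H i j (by omega) (by omega)
      have a1 := ihi j (by omega) (by omega) r hr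
      have a2 := ihi (j + 1) (by omega) (by omega) r hr
      have a3 := ihj (by omega) (by omega) r hr
      have b1 := S.hh r i j (by omega) (by omega) hr
      have b2 := S.hh (r + 1) i j (by omega) (by omega) (by omega)
      have b3 := S.hh r i (j + 1) (by omega) (by omega) hr
      have b4 := S.hh (r + 1) i (j + 1) (by omega) (by omega) (by omega)
      have b5 := S.vv r i j (by omega) (by omega) hr
      have b6 := S.vv (r + 1) i j (by omega) (by omega) (by omega)
      unfold LocRule at l
      grind

theorem Loc.part_bwd {N X h v s} (H : Loc N X h v) (S : Shp N h v s)
    (h0 : ∀ r i, i ≤ N → 1 ≤ r → s (r + 1) i N ≤ s r i N)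
    (v0 : ∀ r j, j ≤ N → 1 ≤ r → s (r + 1) N j ≤ s r N j) (m : ℕ) :
    ∀ i j, i ≤ N → j ≤ N → (N - i) + (N - j) ≤ m →
      ∀ r, 1 ≤ r → s (r + 1) i j ≤ s r i j := by
  induction m with
  | zero =>
    intro i j hi hj hm r hr
    obtain rfl : i = N := by omega
    exact v0 r j hj hr
  | succ m ih =>
    intro i j hi hj hm r hr
    by_cases hiN : i = N
    · subst hiN; exact v0 r j hj hr
    by_cases hjN : j = N
    · subst hjN; exact h0 r i hi hr
    have l := H i j (by omega) (by omega)
    have a1 := ih (i + 1) (j + 1) (by omega) (by omega) (by omega) r hr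
    have a2 := ih i (j + 1) (by omega) (by omega) (by omega) r hr
    have a3 := ih (i + 1) j (by omega) (by omega) (by omega) r hr
    have b1 := S.hh r i j (by omega) (by omega) hr
    have b2 := S.hh (r + 1) i j (by omega) (by omega) (by omega)
    have b3 := S.hh r i (j + 1) (by omega) (by omega) hr
    have b4 := S.hh (r + 1) i (j + 1) (by omega) (by omega) (by omega)
    have b5 := S.vv r i j (by omega) (by omega) hr
    have b6 := S.vv (r + 1) i j (by omega) (by omega) (by omega)
    unfold LocRule at l
    grind

/-- Increasing chains in the rectangle `[0,i) × [0,j)`. -/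
def Inc (X : ℕ → ℕ → Prop) : ℕ → ℕ → ℕ → Prop
  | 0, _, _ => True
  | m + 1, i, j => ∃ i' j', i' < i ∧ j' < j ∧ X i' j' ∧ Inc X m i' j'

theorem Inc.mono {X : ℕ → ℕ → Prop} {m i j i' j' : ℕ} (H : Inc X m i j) (hi : i ≤ i')
    (hj : j ≤ j') : Inc X m i' j' := by
  cases m with
  | zero => trivial
  | succ m =>
    obtain ⟨a, b, ha, hb, h⟩ := H
    exact ⟨a, b, by omega, by omega, h⟩

theorem Loc.inc_of_le {N X h v s} (H : Loc N X h v) (S : Shp N h v s)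
    (h0 : ∀ i, i ≤ N → s 1 i 0 ≤ 0) (v0 : ∀ j, j ≤ N → s 1 0 j ≤ 0) :
    ∀ i j, i ≤ N → j ≤ N → ∀ m : ℕ, (m : ℤ) ≤ s 1 i j → Inc X m i j := by
  intro i
  induction i with
  | zero =>
    intro j hi hj m hm
    obtain rfl : m = 0 := by have := v0 j hj; omega
    trivial
  | succ i ihi =>
    intro j
    induction j with
    | zero =>
      intro hi hj m hm
      obtain rfl : m = 0 := by have := h0 _ hi; omega
      trivial
    | succ j ihj =>
      intro hi hj m hm
      have l := H i j (by omega) (by omega)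
      have b1 := S.hh 1 i j (by omega) (by omega) le_rfl
      have b3 := S.hh 1 i (j + 1) (by omega) (by omega) le_rfl
      have b5 := S.vv 1 i j (by omega) (by omega) le_rfl
      have b6 := S.vv 1 (i + 1) j (by omega) (by omega) le_rfl
      by_cases c1 : h i (j + 1) = 1
      · by_cases c2 : v (i + 1) j = 1
        · cases m with
          | zero => trivial
          | succ m =>
            have hx : X i j ∧ s 1 (i + 1) (j + 1) = s 1 i j + 1 := by
              unfold LocRule at l; grind
            refine ⟨i, j, by omega, by omega, hx.1,
              ihi j (by omega) (by omega) m ?_⟩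
            have := hx.2; push_cast at hm; omega
        · rw [if_neg c2] at b6
          exact (ihj hi (by omega) m (by omega)).mono le_rfl (by omega)
      · rw [if_neg c1] at b3
        exact (ihi (j + 1) (by omega) hj m (by omega)).mono (by omega) le_rfl

theorem Shp.mono_i {N h v s} (S : Shp N h v s) {i i' j : ℕ} (hi : i ≤ i') (hN : i' ≤ N)
    (hj : j ≤ N) : s 1 i j ≤ s 1 i' j := by
  induction i', hi using Nat.le_induction with
  | base => exact le_rfl
  | succ k hk ih =>
    have := ih (by omega)
    rw [S.hh 1 k j (by omega) hj le_rfl]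
    split <;> omega

theorem Shp.mono_j {N h v s} (S : Shp N h v s) {i j j' : ℕ} (hj : j ≤ j') (hN : j' ≤ N)
    (hi : i ≤ N) : s 1 i j ≤ s 1 i j' := by
  induction j', hj using Nat.le_induction with
  | base => exact le_rfl
  | succ k hk ih =>
    have := ih (by omega)
    rw [S.vv 1 i k hi (by omega) le_rfl]
    split <;> omega

theorem Loc.le_of_inc {N X h v s} (H : Loc N X h v) (S : Shp N h v s)
    (h0 : ∀ i j, i ≤ N → j ≤ N → 0 ≤ s 1 i j) (m : ℕ) :
    ∀ i j, i ≤ N → j ≤ N → Inc X m i j → (m : ℤ) ≤ s 1 i j := by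
  induction m with
  | zero => intro i j hi hj _; simpa using h0 i j hi hj
  | succ m ih =>
    rintro i j hi hj ⟨a, b, ha, hb, hx, hI⟩
    have e := ih a b (by omega) (by omega) hI
    have l := H a b (by omega) (by omega)
    have b1 := S.hh 1 a b (by omega) (by omega) le_rfl
    have b3 := S.hh 1 a (b + 1) (by omega) (by omega) le_rfl
    have b5 := S.vv 1 a b (by omega) (by omega) le_rfl
    have m1 := S.mono_i (i := a + 1) (i' := i) (j := b + 1) (by omega) hi (by omega)
    have m2 := S.mono_j (j := b + 1) (j' := j) (i := i) (by omega) hj hi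
    have : s 1 (a + 1) (b + 1) = s 1 a b + 1 := by
      unfold LocRule at l; grind
    push_cast; omega

/-- Nonzero labels come from a cross. -/
theorem Loc.h_ne_zero {N X h v} (H : Loc N X h v) (h0 : ∀ i, i < N → h i 0 = 0)
    (i j : ℕ) (hi : i < N) (hj : j ≤ N) : h i j ≠ 0 ↔ ∃ j' < j, X i j' := by
  induction j with
  | zero => simp [h0 i hi]
  | succ j ih =>
    have e := ih (by omega)
    have l := H i j hi (by omega)
    constructor
    · intro hh
      by_cases c : h i j = 0
      · exact ⟨j, by omega, by unfold LocRule at l; grind⟩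
      · obtain ⟨j', h1, h2⟩ := e.1 c
        exact ⟨j', by omega, h2⟩
    · rintro ⟨j', h1, h2⟩
      rcases Nat.lt_succ_iff_lt_or_eq.1 h1 with h3 | rfl
      · have := e.2 ⟨j', h3, h2⟩
        unfold LocRule at l; grind
      · unfold LocRule at l; grind

theorem Loc.X_unique {N X h v} (H : Loc N X h v) (h0 : ∀ i, i < N → h i 0 = 0)
    {i j j' : ℕ} (hi : i < N) (hj : j < N) (hj' : j' < N) (h1 : X i j) (h2 : X i j') :
    j = j' := by
  rcases lt_trichotomy j j' with h | h | h
  · have := (H.h_ne_zero h0 i j' hi hj'.le).2 ⟨j, h, h1⟩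
    have l := H i j' hi hj'
    unfold LocRule at l; grind
  · exact h
  · have := (H.h_ne_zero h0 i j hi hj.le).2 ⟨j', h, h2⟩
    have l := H i j hi hj
    unfold LocRule at l; grind

/-- Preservation of the descent relation between two adjacent columns. -/
theorem Loc.desc_lt {N X h v} (H : Loc N X h v) {i : ℕ} (hi : i + 1 < N) {j j' : ℕ}
    (hj : j ≤ j') (hN : j' ≤ N) (h1 : h i j < h (i + 1) j) : h i j' < h (i + 1) j' := by
  induction j', hj using Nat.le_induction with
  | base => exact h1
  | succ k hk ih =>
    have := ih (by omega)
    have l1 := H i k (by omega) (by omega)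
    have l2 := H (i + 1) k (by omega) (by omega)
    unfold LocRule at l1 l2; grind

theorem Loc.desc_ge {N X h v} (H : Loc N X h v) {i : ℕ} (hi : i + 1 < N) {j j' : ℕ}
    (hj : j ≤ j') (hN : j' ≤ N) (h1 : h (i + 1) j ≤ h i j) (h2 : h i j ≠ 0) :
    h (i + 1) j' ≤ h i j' ∧ h i j' ≠ 0 := by
  induction j', hj using Nat.le_induction with
  | base => exact ⟨h1, h2⟩
  | succ k hk ih =>
    have := ih (by omega)
    have l1 := H i k (by omega) (by omega)
    have l2 := H (i + 1) k (by omega) (by omega)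
    unfold LocRule at l1 l2; grind

theorem Loc.desc {N X h v} (H : Loc N X h v) (h0 : ∀ i, i < N → h i 0 = 0)
    {i p q : ℕ} (hi : i + 1 < N) (hp : p < N) (hq : q < N) (hX : X i p) (hY : X (i + 1) q)
    (hpq : p ≠ q) : p < q ↔ h (i + 1) N ≤ h i N := by
  constructor
  · intro hlt
    have z : h (i + 1) (p + 1) = 0 := by
      by_contra hc
      obtain ⟨j', hj', hx⟩ := (H.h_ne_zero h0 (i + 1) (p + 1) (by omega) (by omega)).1 hc
      have := H.X_unique h0 hi hq (by omega) hY hx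
      omega
    have z1 : h i (p + 1) ≠ 0 :=
      (H.h_ne_zero h0 i (p + 1) (by omega) (by omega)).2 ⟨p, by omega, hX⟩
    exact (H.desc_ge hi (j := p + 1) (j' := N) (by omega) le_rfl (by omega) z1).1
  · intro hle
    by_contra hc
    have z : h i (q + 1) = 0 := by
      by_contra hc'
      obtain ⟨j', hj', hx⟩ := (H.h_ne_zero h0 i (q + 1) (by omega) (by omega)).1 hc'
      have := H.X_unique h0 (by omega) hp (by omega) hX hx
      omega
    have z1 : h (i + 1) (q + 1) ≠ 0 :=
      (H.h_ne_zero h0 (i + 1) (q + 1) (by omega) (by omega)).2 ⟨q, by omega, hY⟩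
    have := H.desc_lt hi (j := q + 1) (j' := N) (by omega) le_rfl (by omega)
    omega

/-! ### Counting words -/

theorem pc_succ' (w : ℕ → ℕ) (r i : ℕ) :
    pc w r (i + 1) = (if w 0 = r then 1 else 0) + pc (fun k => w (k + 1)) r i := by
  rw [pc, Finset.sum_range_succ', pc, add_comm]

def GoodW (N : ℕ) (f : ℕ → ℤ) (w : ℕ → ℕ) : Prop :=
  (∀ i, i < N → 1 ≤ w i) ∧ (∀ i, N ≤ i → w i = 0) ∧
  (∀ i r, i ≤ N → 1 ≤ r → f (r + 1) + pc w (r + 1) i ≤ f r + pc w r i) ∧ f 1 + pc w 1 N ≤ 3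

theorem goodW_succ (N : ℕ) (f : ℕ → ℤ) (w : ℕ → ℕ) :
    GoodW (N + 1) f w ↔ 1 ≤ w 0 ∧ (∀ r, 1 ≤ r → f (r + 1) ≤ f r) ∧
      GoodW N (fun r => f r + if w 0 = r then 1 else 0) (fun i => w (i + 1)) := by
  unfold GoodW
  constructor
  · rintro ⟨h1, h2, h3, h4⟩
    refine ⟨h1 0 (by omega), fun r hr => by simpa [pc_zero] using h3 0 r (by omega) hr,
      fun i hi => h1 _ (by omega), fun i hi => h2 _ (by omega), fun i r hi hr => ?_, ?_⟩
    · have := h3 (i + 1) r (by omega) hr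
      simp only [pc_succ'] at this
      linarith
    · simp only [pc_succ'] at h4
      linarith
  · rintro ⟨h0, hf, h1, h2, h3, h4⟩
    refine ⟨fun i hi => ?_, fun i hi => ?_, fun i r hi hr => ?_, ?_⟩
    · cases i with
      | zero => exact h0
      | succ i => exact h1 i (by omega)
    · cases i with
      | zero => omega
      | succ i => exact h2 i (by omega)
    · cases i with
      | zero => simpa [pc_zero] using hf r hr
      | succ i =>
        have := h3 i r (by omega) hr
        simp only [pc_succ']
        linarith
    · simp only [pc_succ']
      linarith

theorem GoodW.start {N : ℕ} {f : ℕ → ℤ} {w : ℕ → ℕ} (H : GoodW N f w) :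
    (∀ r, 1 ≤ r → f (r + 1) ≤ f r) ∧ f 1 ≤ 3 := by
  obtain ⟨_, _, h3, h4⟩ := H
  refine ⟨fun r hr => by simpa [pc_zero] using h3 0 r (by omega) hr, ?_⟩
  have := pc_nonneg w 1 N
  linarith

def rowsOf (a b c r : ℕ) : ℤ :=
  (if r ≤ a then 1 else 0) + (if r ≤ b then 1 else 0) + (if r ≤ c then 1 else 0)

theorem rowsOf_a (a b c r : ℕ) :
    (rowsOf a b c r + if a + 1 = r then 1 else 0) = rowsOf (a + 1) b c r := by
  unfold rowsOf; split_ifs <;> omega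

theorem rowsOf_b (a b c r : ℕ) :
    (rowsOf a b c r + if b + 1 = r then 1 else 0) = rowsOf a (b + 1) c r := by
  unfold rowsOf; split_ifs <;> omega

theorem rowsOf_c (a b c r : ℕ) :
    (rowsOf a b c r + if c + 1 = r then 1 else 0) = rowsOf a b (c + 1) r := by
  unfold rowsOf; split_ifs <;> omega

theorem rowsOf_anti (a b c r : ℕ) : rowsOf a b c (r + 1) ≤ rowsOf a b c r := by
  unfold rowsOf; split_ifs <;> omega

theorem rowsOf_le (a b c r : ℕ) : rowsOf a b c r ≤ 3 := by
  unfold rowsOf; split_ifs <;> omega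

theorem addable {a b c x : ℕ} (hb : b ≤ a) (hc : c ≤ b) (hx : 1 ≤ x)
    (h1 : ∀ r, 1 ≤ r → (rowsOf a b c (r + 1) + if x = r + 1 then 1 else 0) ≤
      rowsOf a b c r + if x = r then 1 else 0)
    (h2 : (rowsOf a b c 1 + if x = 1 then 1 else 0) ≤ 3) :
    x = a + 1 ∨ (x = b + 1 ∧ b < a) ∨ (x = c + 1 ∧ c < b) := by
  unfold rowsOf at *
  by_cases h : x = 1
  · subst h
    clear h1
    split_ifs at h2 <;> omega
  · have := h1 (x - 1) (by omega)
    clear h1 h2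
    split_ifs at this <;> omega

def cons2 (x y : ℕ) (u : ℕ → ℕ) : ℕ → ℕ
  | 0 => x
  | 1 => y
  | k + 2 => u k

theorem cons2_inj (x y : ℕ) : Function.Injective (cons2 x y) := by
  intro u u' h
  funext k
  exact congrFun h (k + 2)

theorem cons2_eq (x y : ℕ) (u w : ℕ → ℕ) :
    cons2 x y u = w ↔ w 0 = x ∧ w 1 = y ∧ u = fun k => w (k + 2) := by
  constructor
  · rintro rfl; exact ⟨rfl, rfl, rfl⟩
  · rintro ⟨rfl, rfl, rfl⟩
    funext k
    match k with
    | 0 => rfl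
    | 1 => rfl
    | k + 2 => rfl

open Classical in
noncomputable def VF : ℕ → ℕ → ℕ → ℕ → Finset (ℕ → ℕ)
  | 0, _, _, _ => {fun _ => 0}
  | n + 1, a, b, c =>
    (VF n (a + 1) (b + 1) c).image (cons2 (a + 1) (b + 1)) ∪
    ((if c < b then (VF n (a + 1) b (c + 1)).image (cons2 (a + 1) (c + 1)) else ∅) ∪
    (if b < a then (VF n a (b + 1) (c + 1)).image (cons2 (b + 1) (c + 1)) else ∅))

theorem mem_VF_succ (n a b c : ℕ) (w : ℕ → ℕ) : w ∈ VF (n + 1) a b c ↔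
    (w 0 = a + 1 ∧ w 1 = b + 1 ∧ (fun k => w (k + 2)) ∈ VF n (a + 1) (b + 1) c) ∨
    (c < b ∧ w 0 = a + 1 ∧ w 1 = c + 1 ∧ (fun k => w (k + 2)) ∈ VF n (a + 1) b (c + 1)) ∨
    (b < a ∧ w 0 = b + 1 ∧ w 1 = c + 1 ∧ (fun k => w (k + 2)) ∈ VF n a (b + 1) (c + 1)) := by
  classical
  have key : ∀ (x y : ℕ) (S : Finset (ℕ → ℕ)), (∃ u ∈ S, cons2 x y u = w) ↔
      (w 0 = x ∧ w 1 = y ∧ (fun k => w (k + 2)) ∈ S) := by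
    intro x y S
    constructor
    · rintro ⟨u, hu, h⟩
      obtain ⟨h1, h2, rfl⟩ := (cons2_eq _ _ _ _).1 h
      exact ⟨h1, h2, hu⟩
    · rintro ⟨h1, h2, h3⟩
      exact ⟨_, h3, (cons2_eq _ _ _ _).2 ⟨h1, h2, rfl⟩⟩
  rw [VF, Finset.mem_union, Finset.mem_union, Finset.mem_image, key]
  apply or_congr Iff.rfl
  apply or_congr
  · split_ifs with h <;> simp [h, key]
  · split_ifs with h <;> simp [h, key]

theorem VF_first {n a b c : ℕ} {w : ℕ → ℕ} (hb : b ≤ a) (h : w ∈ VF (n + 1) a b c) :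
    b + 1 ≤ w 0 := by
  rw [mem_VF_succ] at h
  rcases h with h | h | h <;> omega

theorem mem_VF (n : ℕ) : ∀ (a b c : ℕ) (w : ℕ → ℕ), b ≤ a → c ≤ b →
    (w ∈ VF n a b c ↔ GoodW (2 * n) (rowsOf a b c) w ∧
      ∀ i, i + 1 < 2 * n → (w (i + 1) ≤ w i ↔ Even i)) := by
  induction n with
  | zero =>
    intro a b c w hb hc
    simp only [VF, Finset.mem_singleton, GoodW]
    constructor
    · rintro rfl
      refine ⟨⟨fun i hi => by omega, fun _ _ => rfl, fun i r hi hr => ?_, ?_⟩, fun i hi => by omega⟩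
      · obtain rfl : i = 0 := by omega
        simpa [pc_zero] using rowsOf_anti a b c r
      · simpa [pc_zero] using rowsOf_le a b c 1
    · rintro ⟨⟨_, h, _⟩, _⟩
      funext i
      exact h i (by omega)
  | succ n ih =>
    intro a b c w hb hc
    have hN : 2 * (n + 1) = 2 * n + 1 + 1 := by ring
    rw [mem_VF_succ, hN, goodW_succ, goodW_succ]
    have alt : ∀ a' b' c', b' ≤ a' → c' ≤ b' → w 1 ≤ w 0 → w 1 < b' + 1 →
        (fun k => w (k + 2)) ∈ VF n a' b' c' →
        ∀ i, i + 1 < 2 * n + 1 + 1 → (w (i + 1) ≤ w i ↔ Even i) := by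
      intro a' b' c' hb' hc' h10 h1b hV i hi
      match i with
      | 0 => simpa using h10
      | 1 =>
        cases n with
        | zero => omega
        | succ n =>
          have := VF_first hb' hV
          have h2 : ¬ w 2 ≤ w 1 := by simp at this; omega
          simp [h2]
      | i + 2 =>
        have := ((ih a' b' c' _ hb' hc').1 hV).2 i (by omega)
        rw [show i + 2 + 1 = i + 1 + 2 by ring, this]
        grind
    constructor
    · rintro (⟨h0, h1, hV⟩ | ⟨hlt, h0, h1, hV⟩ | ⟨hlt, h0, h1, hV⟩)
      · refine ⟨⟨by omega, fun r _ => rowsOf_anti a b c r, by show 1 ≤ w 1; omega, ?_, ?_⟩,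
          alt _ _ _ (by omega) (by omega) (by omega) (by omega) hV⟩
        · intro r _
          simp only [h0, rowsOf_a]
          exact rowsOf_anti _ _ _ _
        · simp only [h0, h1, rowsOf_a, rowsOf_b, zero_add]
          exact ((ih _ _ _ _ (by omega) (by omega)).1 hV).1
      · refine ⟨⟨by omega, fun r _ => rowsOf_anti a b c r, by show 1 ≤ w 1; omega, ?_, ?_⟩,
          alt _ _ _ (by omega) (by omega) (by omega) (by omega) hV⟩
        · intro r _
          simp only [h0, rowsOf_a]
          exact rowsOf_anti _ _ _ _
        · simp only [h0, h1, rowsOf_a, rowsOf_c, zero_add]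
          exact ((ih _ _ _ _ (by omega) (by omega)).1 hV).1
      · refine ⟨⟨by omega, fun r _ => rowsOf_anti a b c r, by show 1 ≤ w 1; omega, ?_, ?_⟩,
          alt _ _ _ (by omega) (by omega) (by omega) (by omega) hV⟩
        · intro r _
          simp only [h0, rowsOf_b]
          exact rowsOf_anti _ _ _ _
        · simp only [h0, h1, rowsOf_b, rowsOf_c, zero_add]
          exact ((ih _ _ _ _ (by omega) (by omega)).1 hV).1
    · rintro ⟨⟨p0, _, p1, an1, G⟩, al⟩
      simp only [zero_add] at p1 G
      have h10 : w 1 ≤ w 0 := by simpa using al 0 (by omega)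
      have al' : ∀ i, i + 1 < 2 * n → (w (i + 1 + 2) ≤ w (i + 2) ↔ Even i) := by
        intro i hi
        have := al (i + 2) (by omega)
        rw [show i + 1 + 2 = i + 2 + 1 by ring, this]
        grind
      have st := G.start
      have l1 : (rowsOf a b c 1 + if w 0 = 1 then 1 else 0) ≤ 3 := by
        have := st.2
        split_ifs at this ⊢ <;> omega
      rcases addable hb hc p0 an1 l1 with h0 | ⟨h0, hlt⟩ | ⟨h0, hlt⟩
      · simp only [h0, rowsOf_a] at G st
        rcases addable (by omega) hc p1 st.1 st.2 with h1 | ⟨h1, hlt1⟩ | ⟨h1, hlt1⟩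
        · omega
        · simp only [h1, rowsOf_b] at G
          exact Or.inl ⟨h0, h1, (ih _ _ _ _ (by omega) (by omega)).2 ⟨G, al'⟩⟩
        · simp only [h1, rowsOf_c] at G
          exact Or.inr (Or.inl ⟨hlt1, h0, h1, (ih _ _ _ _ (by omega) (by omega)).2 ⟨G, al'⟩⟩)
      · simp only [h0, rowsOf_b] at G st
        rcases addable (by omega) (by omega) p1 st.1 st.2 with h1 | ⟨h1, hlt1⟩ | ⟨h1, hlt1⟩
        · omega
        · omega
        · simp only [h1, rowsOf_c] at G
          exact Or.inr (Or.inr ⟨hlt, h0, h1, (ih _ _ _ _ (by omega) (by omega)).2 ⟨G, al'⟩⟩)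
      · simp only [h0, rowsOf_c] at G st
        rcases addable hb (by omega) p1 st.1 st.2 with h1 | ⟨h1, hlt1⟩ | ⟨h1, hlt1⟩ <;> omega

/-- Positive Motzkin-type walks of length `n` starting at `d`, ending anywhere. -/
def mm : ℕ → ℕ → ℤ
  | 0, d => if d = 0 then 0 else 1
  | n + 1, d => if d = 0 then 0 else mm n (d + 1) + mm n d + mm n (d - 1)

/-- Positive Motzkin-type walks of length `n` starting at `d`, ending at `1`. -/
def ee : ℕ → ℕ → ℤ
  | 0, d => if d = 1 then 1 else 0
  | n + 1, d => if d = 0 then 0 else ee n (d + 1) + ee n d + ee n (d - 1)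

theorem mm_zero (n : ℕ) : mm n 0 = 0 := by cases n <;> simp [mm]

theorem mm_succ (n d : ℕ) : mm (n + 1) (d + 1) = mm n (d + 2) + mm n (d + 1) + mm n d := by
  simp [mm]

theorem ee_succ (n d : ℕ) : ee (n + 1) (d + 1) = ee n (d + 2) + ee n (d + 1) + ee n d := by
  simp [ee]

theorem ee_zero (n : ℕ) : ee n 0 = 0 := by cases n <;> simp [ee]

theorem mm_ee (n : ℕ) : ∀ d, mm (n + 1) d = 3 * mm n d - ee n d := by
  induction n with
  | zero =>
    intro d
    match d with
    | 0 => simp [mm, ee]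
    | 1 => simp [mm, ee]
    | d + 2 => simp [mm, ee]
  | succ n ih =>
    intro d
    cases d with
    | zero => simp [mm_zero, ee_zero]
    | succ d =>
      have h2 := ih (d + 1)
      rw [mm_succ] at h2
      rw [mm_succ, ih, ih, ih, ee_succ]; linarith

theorem card_VF (n : ℕ) : ∀ (x y c : ℕ),
    ((VF n (x + y + c) (y + c) c).card : ℤ) = mm n (x + 1) + mm n (y + 1) - mm n (x + y + 2) := by
  classical
  induction n with
  | zero => intro x y c; simp [VF, mm]
  | succ n ih =>
    intro x y c
    rw [VF, Finset.card_union_of_disjoint, Finset.card_union_of_disjoint]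
    · rw [Finset.card_image_of_injective _ (cons2_inj _ _)]
      have e1 : ((VF n (x + y + c + 1) (y + c + 1) c).card : ℤ) =
          mm n (x + 1) + mm n (y + 2) - mm n (x + y + 3) := by
        have := ih x (y + 1) c
        rw [show x + (y + 1) + c = x + y + c + 1 by ring, show y + 1 + c = y + c + 1 by ring] at this
        exact this
      have e2 : (((if c < y + c then (VF n (x + y + c + 1) (y + c) (c + 1)).image
          (cons2 (x + y + c + 1) (c + 1)) else ∅ : Finset (ℕ → ℕ)).card : ℕ) : ℤ) =
          mm n (x + 2) + mm n y - mm n (x + y + 2) := by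
        cases y with
        | zero => simp [mm_zero]
        | succ y =>
          rw [if_pos (by omega), Finset.card_image_of_injective _ (cons2_inj _ _)]
          have := ih (x + 1) y (c + 1)
          rw [show x + 1 + y + (c + 1) = x + (y + 1) + c + 1 by ring,
            show y + (c + 1) = y + 1 + c by ring] at this
          rw [this]; ring_nf
      have e3 : (((if y + c < x + y + c then (VF n (x + y + c) (y + c + 1) (c + 1)).image
          (cons2 (y + c + 1) (c + 1)) else ∅ : Finset (ℕ → ℕ)).card : ℕ) : ℤ) =
          mm n x + mm n (y + 1) - mm n (x + y + 1) := by
        cases x with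
        | zero => simp [mm_zero]
        | succ x =>
          rw [if_pos (by omega), Finset.card_image_of_injective _ (cons2_inj _ _)]
          have := ih x y (c + 1)
          rw [show x + y + (c + 1) = x + 1 + y + c by ring,
            show y + (c + 1) = y + c + 1 by ring] at this
          rw [this]; ring_nf
      push_cast
      rw [e1, e2, e3, mm_succ, mm_succ, show x + y + 2 = x + y + 1 + 1 by ring, mm_succ]
      ring_nf
    · rw [Finset.disjoint_left]
      intro w h1 h2
      split_ifs at h1 h2 <;> simp only [Finset.mem_image, cons2_eq, Finset.notMem_empty] at h1 h2
      obtain ⟨_, _, h1, _⟩ := h1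
      obtain ⟨_, _, h2, _⟩ := h2
      omega
    · rw [Finset.disjoint_left]
      intro w h1 h2
      rw [Finset.mem_union] at h2
      simp only [Finset.mem_image, cons2_eq] at h1
      obtain ⟨_, _, h1, h1', _⟩ := h1
      rcases h2 with h2 | h2
      · split_ifs at h2 <;> simp only [Finset.mem_image, cons2_eq, Finset.notMem_empty] at h2
        obtain ⟨_, _, h2, h2', _⟩ := h2
        omega
      · split_ifs at h2 <;> simp only [Finset.mem_image, cons2_eq, Finset.notMem_empty] at h2
        obtain ⟨_, _, h2, h2', _⟩ := h2
        omega

open PowerSeries in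
theorem ee_one (M : ℕ → ℕ) (hM0 : M 0 = 1)
    (hMrec : ∀ n, M (n + 1) = M n + ∑ k ∈ Finset.range n, M k * M (n - 1 - k)) (n : ℕ) :
    ee n 1 = M n := by
  set S : PowerSeries ℤ := PowerSeries.mk (fun n => (M n : ℤ)) with hS
  have hfun : S = 1 + X * (S + X * (S * S)) := by
    ext m
    cases m with
    | zero => simp [hS, hM0]
    | succ m =>
      rw [map_add, coeff_succ_X_mul, map_add]
      have h1 : coeff (m + 1) (1 : PowerSeries ℤ) = 0 := by simp [coeff_one]
      rw [h1]
      cases m with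
      | zero => simp [hS, hMrec]
      | succ m =>
        rw [coeff_succ_X_mul, coeff_mul, Finset.Nat.sum_antidiagonal_eq_sum_range_succ_mk]
        simp [hS, hMrec (m + 1)]
  have key : ∀ n d, ee n (d + 1) = coeff n (X ^ d * S ^ (d + 1)) := by
    intro n
    induction n with
    | zero =>
      intro d
      cases d with
      | zero => simp [ee, hS, hM0]
      | succ d => simp [ee]
    | succ n ih =>
      intro d
      rw [ee_succ, ih, ih]
      cases d with
      | zero =>
        have : (X ^ 0 * S ^ (0 + 1) : PowerSeries ℤ) =
            1 + X * (X ^ 0 * S ^ (0 + 1) + X ^ 1 * S ^ (0 + 1 + 1)) := by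
          conv_lhs => rw [pow_zero, one_mul, zero_add, pow_one, hfun]
          ring
        conv_rhs => rw [this]
        rw [ee_zero, map_add, coeff_succ_X_mul, map_add]
        simp [coeff_one]
        ring
      | succ d =>
        rw [ih]
        have : (X ^ (d + 1) * S ^ (d + 1 + 1) : PowerSeries ℤ) =
            X * (X ^ d * S ^ (d + 1) + X ^ (d + 1) * S ^ (d + 1 + 1)
              + X ^ (d + 1 + 1) * S ^ (d + 1 + 1 + 1)) := by
          calc (X ^ (d + 1) * S ^ (d + 1 + 1) : PowerSeries ℤ)
              = X ^ (d + 1) * S ^ (d + 1) * S := by ring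
            _ = X ^ (d + 1) * S ^ (d + 1) * (1 + X * (S + X * (S * S))) := by rw [← hfun]
            _ = _ := by ring
        conv_rhs => rw [this]
        rw [coeff_succ_X_mul, map_add, map_add]
        ring
  have := key n 0
  simpa [hS] using this

theorem card_VF_motzkin (M : ℕ → ℕ) (hM0 : M 0 = 1)
    (hMrec : ∀ n, M (n + 1) = M n + ∑ k ∈ Finset.range n, M k * M (n - 1 - k)) (n : ℕ) :
    (VF n 0 0 0).card = M n := by
  have h := card_VF n 0 0 0
  have h2 := mm_ee n 1
  rw [ee_one M hM0 hMrec] at h2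
  have h3 := mm_succ n 0
  rw [mm_zero] at h3
  simp only [zero_add] at h h3
  have : ((VF n 0 0 0).card : ℤ) = M n := by rw [h]; linarith
  exact_mod_cast this

/-! ### The bijection -/

def Xof {N : ℕ} (π : Equiv.Perm (Fin N)) (i j : ℕ) : Prop :=
  ∃ k : Fin N, k.val = i ∧ (π k).val = j

structure IsGrid (N : ℕ) (X : ℕ → ℕ → Prop) (h v : ℕ → ℕ → ℕ) : Prop where
  loc : Loc N X h v
  h0 : ∀ i, i < N → h i 0 = 0
  v0 : ∀ j, j < N → v 0 j = 0

theorem exists_isGrid {N : ℕ} (π : Equiv.Perm (Fin N)) : ∃ h v, IsGrid N (Xof π) h v := by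
  classical
  obtain ⟨h, v, h0, v0, st⟩ := exists_grid (fun j i a b => if Xof π i j then (1, 1) else
    if a = b ∧ a ≠ 0 then (a + 1, a + 1) else (a, b)) (fun _ => 0) (fun _ => 0)
  have hh : ∀ i j, h i j ≠ 0 → ∃ j' < j, Xof π i j' := by
    intro i j
    induction j with
    | zero => intro hc; exact absurd (h0 i) hc
    | succ j ih =>
      intro hc
      by_cases hx : Xof π i j
      · exact ⟨j, by omega, hx⟩
      · have := st i j
        simp only [hx, if_false] at this
        have hne : h i j ≠ 0 := by
          intro hz
          simp [hz] at this
          exact hc this.1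
        obtain ⟨j', h1, h2⟩ := ih hne
        exact ⟨j', by omega, h2⟩
  have hv : ∀ i j, v i j ≠ 0 → ∃ i' < i, Xof π i' j := by
    intro i j
    induction i with
    | zero => intro hc; exact absurd (v0 j) hc
    | succ i ih =>
      intro hc
      by_cases hx : Xof π i j
      · exact ⟨i, by omega, hx⟩
      · have := st i j
        simp only [hx, if_false] at this
        have hne : v i j ≠ 0 := by
          intro hz
          rw [hz] at this
          split_ifs at this with h1
          · exact h1.2 h1.1
          · simp at this
            exact hc this.2
        obtain ⟨j', h1, h2⟩ := ih hne
        exact ⟨j', by omega, h2⟩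
  refine ⟨h, v, ⟨?_, fun i _ => h0 i, fun j _ => v0 j⟩⟩
  intro i j hi hj
  have s := st i j
  by_cases hx : Xof π i j
  · left
    have e1 : h i j = 0 := by
      by_contra hc
      obtain ⟨j', h1, k, hk, hk'⟩ := hh i j hc
      obtain ⟨k2, hk2, hk2'⟩ := hx
      have : k = k2 := Fin.ext (by omega)
      subst this
      omega
    have e2 : v i j = 0 := by
      by_contra hc
      obtain ⟨j', h1, k, hk, hk'⟩ := hv i j hc
      obtain ⟨k2, hk2, hk2'⟩ := hx
      have : k = k2 := π.injective (Fin.ext (by omega))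
      subst this
      omega
    simp only [hx, if_true, Prod.mk.injEq] at s
    exact ⟨hx, e1, e2, s.1, s.2⟩
  · right
    simp only [hx, if_false] at s
    split_ifs at s with hc
    · simp only [Prod.mk.injEq] at s
      exact Or.inl ⟨hx, hc.1, hc.2, s.1, s.2⟩
    · simp only [Prod.mk.injEq] at s
      exact Or.inr ⟨hx, by omega, s.1, s.2⟩

theorem Xof_self {N : ℕ} (π : Equiv.Perm (Fin N)) (k : Fin N) : Xof π k (π k) := ⟨k, rfl, rfl⟩

theorem IsGrid.alternating {N : ℕ} {π : Equiv.Perm (Fin N)} {h v} (G : IsGrid N (Xof π) h v) :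
    IsAlternating π ↔ ∀ i, i + 1 < N → (h (i + 1) N ≤ h i N ↔ Even i) := by
  have key : ∀ (i : ℕ) (hi : i + 1 < N), (π ⟨i, by omega⟩ < π ⟨i + 1, hi⟩) ↔
      h (i + 1) N ≤ h i N := by
    intro i hi
    rw [Fin.lt_def]
    apply G.loc.desc G.h0 hi (Fin.isLt _) (Fin.isLt _) (Xof_self π ⟨i, by omega⟩)
      (Xof_self π ⟨i + 1, hi⟩)
    intro hc
    have := π.injective (Fin.ext hc)
    simp at this
  have par : ∀ i : ℕ, Odd (i + 1) ↔ Even i := by intro i; grind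
  constructor
  · intro H i hi
    rw [← key i hi, ← par]
    exact H ⟨i, by omega⟩ hi
  · intro H i hi
    rw [par, ← H i hi]
    exact key i hi

theorem p1234_apply (a : Fin 4) : p1234 a = a := by revert a; decide

theorem contains_iff {N : ℕ} (π : Equiv.Perm (Fin N)) :
    Contains π p1234 ↔ Inc (Xof π) 4 N N := by
  constructor
  · rintro ⟨f, hf, h⟩
    have h' : ∀ a b : Fin 4, a < b → (π (f a)).val < (π (f b)).val := by
      intro a b hab
      have := (h a b).2 (by rw [p1234_apply, p1234_apply]; exact hab)
      exact this
    have hf' : ∀ a b : Fin 4, a < b → (f a).val < (f b).val := fun a b hab => hf hab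
    exact ⟨f 3, π (f 3), Fin.isLt _, Fin.isLt _, Xof_self _ _,
      f 2, π (f 2), hf' _ _ (by decide), h' _ _ (by decide), Xof_self _ _,
      f 1, π (f 1), hf' _ _ (by decide), h' _ _ (by decide), Xof_self _ _,
      f 0, π (f 0), hf' _ _ (by decide), h' _ _ (by decide), Xof_self _ _, trivial⟩
  · rintro ⟨_, _, _, _, ⟨k3, rfl, rfl⟩, _, _, a2, b2, ⟨k2, rfl, rfl⟩, _, _, a1, b1,
      ⟨k1, rfl, rfl⟩, _, _, a0, b0, ⟨k0, rfl, rfl⟩, _⟩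
    have s1 : StrictMono ![k0, k1, k2, k3] := by
      rw [Fin.strictMono_iff_lt_succ]
      intro i
      fin_cases i
      · exact a0
      · exact a1
      · exact a2
    have s2 : StrictMono (fun a => π (![k0, k1, k2, k3] a)) := by
      rw [Fin.strictMono_iff_lt_succ]
      intro i
      fin_cases i
      · exact b0
      · exact b1
      · exact b2
    refine ⟨![k0, k1, k2, k3], s1, fun a b => ?_⟩
    rw [p1234_apply, p1234_apply]
    exact s2.lt_iff_lt

theorem IsGrid.shp {N X h v} (G : IsGrid N X h v) :
    Shp N h v (fun r i j => pc (fun k => h k j) r i) := G.loc.shp_fwd G.v0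

theorem IsGrid.pc_bottom {N X h v} (G : IsGrid N X h v) (r i : ℕ) (hr : 1 ≤ r) (hi : i ≤ N) :
    pc (fun k => h k 0) r i = 0 := by
  apply Finset.sum_eq_zero
  intro k hk
  have := Finset.mem_range.1 hk
  show (if h k 0 = r then (1:ℤ) else 0) = 0
  rw [G.h0 k (by omega), if_neg (by omega)]

theorem IsGrid.avoids {N : ℕ} {π : Equiv.Perm (Fin N)} {h v} (G : IsGrid N (Xof π) h v) :
    Avoids π p1234 ↔ pc (fun k => h k N) 1 N ≤ 3 := by
  rw [Avoids, contains_iff]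
  have S := G.shp
  constructor
  · intro H
    by_contra hc
    apply H
    exact G.loc.inc_of_le S (fun i hi => (G.pc_bottom 1 i le_rfl hi).le)
      (fun j _ => (pc_zero _ _).le) N N le_rfl le_rfl 4 (by push_cast; omega)
  · intro H hI
    have := G.loc.le_of_inc S (fun i j _ _ => pc_nonneg _ _ _) 4 N N le_rfl le_rfl hI
    push_cast at this
    omega

theorem IsGrid.yam {N X h v} (G : IsGrid N X h v) (i r : ℕ) (hi : i ≤ N) (hr : 1 ≤ r) :
    pc (fun k => h k N) (r + 1) i ≤ pc (fun k => h k N) r i :=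
  G.loc.part_fwd G.shp
    (fun r i hi hr => by
      rw [G.pc_bottom r i hr hi, G.pc_bottom (r + 1) i (by omega) hi])
    (fun r j _ _ => by rw [pc_zero, pc_zero]) i N hi le_rfl r hr

theorem IsGrid.transpose {N X h v} (G : IsGrid N X h v) :
    IsGrid N (fun i j => X j i) (fun i j => v j i) (fun i j => h j i) :=
  ⟨G.loc.transpose, G.v0, G.h0⟩

theorem Xof_symm {N : ℕ} {π : Equiv.Perm (Fin N)} (hπ : IsInvolution π) (i j : ℕ) :
    Xof π i j ↔ Xof π j i := by
  have : ∀ i j, Xof π i j → Xof π j i := by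
    rintro i j ⟨k, rfl, rfl⟩
    exact ⟨π k, rfl, by rw [hπ k]⟩
  exact ⟨this i j, this j i⟩

theorem IsGrid.symm {N X h v} (G : IsGrid N X h v)
    (hX : ∀ i j, i < N → j < N → (X i j ↔ X j i)) (i : ℕ) (hi : i < N) : h i N = v N i :=
  (G.loc.fwd_unique G.transpose.loc hX (fun i hi => by rw [G.h0 i hi, G.v0 i hi])
    (fun j hj => by rw [G.h0 j hj, G.v0 j hj]) _ i N hi.le le_rfl le_rfl).1 hi

noncomputable def gh {N : ℕ} (π : Equiv.Perm (Fin N)) : ℕ → ℕ → ℕ :=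
  (exists_isGrid π).choose

noncomputable def gv {N : ℕ} (π : Equiv.Perm (Fin N)) : ℕ → ℕ → ℕ :=
  (exists_isGrid π).choose_spec.choose

theorem g_isGrid {N : ℕ} (π : Equiv.Perm (Fin N)) : IsGrid N (Xof π) (gh π) (gv π) :=
  (exists_isGrid π).choose_spec.choose_spec

noncomputable def wordOf {N : ℕ} (π : Equiv.Perm (Fin N)) (i : ℕ) : ℕ :=
  if i < N then gh π i N else 0

theorem pc_wordOf {N : ℕ} (π : Equiv.Perm (Fin N)) (r i : ℕ) (hi : i ≤ N) :
    pc (wordOf π) r i = pc (fun k => gh π k N) r i :=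
  pc_congr (fun k hk => by rw [wordOf, if_pos (by omega)])

theorem rowsOf_zero (r : ℕ) (hr : 1 ≤ r) : rowsOf 0 0 0 r = 0 := by
  unfold rowsOf; split_ifs <;> omega

theorem wordOf_good {N : ℕ} (π : Equiv.Perm (Fin N)) (hA : Avoids π p1234) :
    GoodW N (rowsOf 0 0 0) (wordOf π) := by
  have G := g_isGrid π
  refine ⟨fun i hi => ?_, fun i hi => ?_, fun i r hi hr => ?_, ?_⟩
  · rw [wordOf, if_pos hi]
    have := (G.loc.h_ne_zero G.h0 i N hi le_rfl).2 ⟨_, Fin.isLt _, Xof_self π ⟨i, hi⟩⟩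
    omega
  · rw [wordOf, if_neg (by omega)]
  · rw [rowsOf_zero r hr, rowsOf_zero (r + 1) (by omega), pc_wordOf π _ _ hi, pc_wordOf π _ _ hi]
    simpa using G.yam i r hi hr
  · rw [rowsOf_zero 1 le_rfl, pc_wordOf π _ _ le_rfl]
    simpa using G.avoids.1 hA

theorem wordOf_inj {N : ℕ} {π ρ : Equiv.Perm (Fin N)} (hπ : IsInvolution π)
    (hρ : IsInvolution ρ) (h : wordOf π = wordOf ρ) : π = ρ := by
  have G := g_isGrid π
  have K := g_isGrid ρ
  have e : ∀ i, i < N → gh π i N = gh ρ i N := by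
    intro i hi
    have := congrFun h i
    rwa [wordOf, wordOf, if_pos hi, if_pos hi] at this
  have e' : ∀ i, i < N → gv π N i = gv ρ N i := by
    intro i hi
    rw [← G.symm (fun i j _ _ => Xof_symm hπ i j) i hi,
      ← K.symm (fun i j _ _ => Xof_symm hρ i j) i hi, e i hi]
  have X := G.loc.bwd_X K.loc e e'
  ext k
  obtain ⟨k', h1, h2⟩ := (X k (π k) (Fin.isLt _) (Fin.isLt _)).1 (Xof_self π k)
  obtain rfl : k' = k := Fin.ext h1
  exact h2.symm

theorem pc_eq_zero {w : ℕ → ℕ} {r N : ℕ} (h : pc w r N ≤ 0) (k : ℕ) (hk : k < N) : w k ≠ r := by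
  intro hc
  have h1 : (1 : ℤ) ≤ pc w r N := by
    have := Finset.single_le_sum (f := fun k => if w k = r then (1 : ℤ) else 0)
      (s := Finset.range N) (fun i _ => by positivity) (Finset.mem_range.2 hk)
    simpa [pc, hc] using this
  omega

theorem backward {N : ℕ} {w : ℕ → ℕ} (hw : GoodW N (rowsOf 0 0 0) w) :
    ∃ X h v, IsGrid N X h v ∧ (∀ i, i < N → h i N = w i) ∧
      ∀ i j, i < N → j < N → (X i j ↔ X j i) := by
  obtain ⟨H, V, H0, V0, st⟩ := exists_grid (fun _ _ a b => if a = b ∧ a ≠ 0 then (a - 1, b - 1)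
    else (a, b)) (fun i => w (N - 1 - i)) (fun i => w (N - 1 - i))
  obtain ⟨h, hdef⟩ : ∃ h : ℕ → ℕ → ℕ, ∀ i j, h i j = H (N - 1 - i) (N - j) := ⟨_, fun _ _ => rfl⟩
  obtain ⟨v, vdef⟩ : ∃ v : ℕ → ℕ → ℕ, ∀ i j, v i j = V (N - i) (N - 1 - j) := ⟨_, fun _ _ => rfl⟩
  obtain ⟨X, Xdef⟩ : ∃ X : ℕ → ℕ → Prop, ∀ i j, X i j ↔ (h i (j + 1) = 1 ∧ v (i + 1) j = 1) :=
    ⟨_, fun _ _ => Iff.rfl⟩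
  have loc : Loc N X h v := by
    intro i j hi hj
    have s := st (N - 1 - i) (N - 1 - j)
    have e1 : h i j = H (N - 1 - i) (N - 1 - j + 1) := by rw [hdef]; congr 1; omega
    have e2 : v i j = V (N - 1 - i + 1) (N - 1 - j) := by rw [vdef]; congr 1; omega
    have e3 : h i (j + 1) = H (N - 1 - i) (N - 1 - j) := by rw [hdef]; congr 1; omega
    have e4 : v (i + 1) j = V (N - 1 - i) (N - 1 - j) := by rw [vdef]; congr 1; omega
    have hx := Xdef i j
    rw [← e1, ← e2, ← e3, ← e4] at s
    generalize h i j = a at *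
    generalize v i j = b at *
    generalize h i (j + 1) = a' at *
    generalize v (i + 1) j = b' at *
    unfold LocRule
    rw [hx]
    split_ifs at s with hc <;> simp only [Prod.mk.injEq] at s
    · by_cases h1 : a' = 1
      · left; omega
      · right; left; omega
    · right; right; omega
  have hN : ∀ i, i < N → h i N = w i := by
    intro i hi
    rw [hdef, Nat.sub_self, H0]; congr 1; omega
  have vN : ∀ i, i < N → v N i = w i := by
    intro i hi
    rw [vdef, Nat.sub_self, V0]; congr 1; omega
  have e1 : ∀ i, i < N → h i N = v N i := fun i hi => by rw [hN i hi, vN i hi]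
  have e2 : ∀ i, i < N → v N i = h i N := fun i hi => (e1 i hi).symm
  have Xs : ∀ i j, i < N → j < N → (X i j ↔ X j i) := loc.bwd_X loc.transpose e1 e2
  obtain ⟨_, _, w3, w4⟩ := hw
  have yam : ∀ i r, i ≤ N → 1 ≤ r → pc w (r + 1) i ≤ pc w r i := by
    intro i r hi hr
    have := w3 i r hi hr
    rw [rowsOf_zero r hr, rowsOf_zero (r + 1) (by omega)] at this
    linarith
  have S : Shp N h v (fun r i j => pc w r i - pc (v i) r N + pc (v i) r j) := by
    have vv : ∀ r i j, pc w r i - pc (v i) r N + pc (v i) r (j + 1) =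
        pc w r i - pc (v i) r N + pc (v i) r j + if v i j = r then 1 else 0 := by
      intro r i j; rw [pc_succ]; ring
    refine ⟨fun r i j hi hj hr => ?_, fun r i j hi hj hr => vv r i j⟩
    have key : ∀ d j, j + d = N → pc w r (i + 1) - pc (v (i + 1)) r N + pc (v (i + 1)) r j =
        pc w r i - pc (v i) r N + pc (v i) r j + if h i j = r then 1 else 0 := by
      intro d
      induction d with
      | zero =>
        intro j hjd
        obtain rfl : j = N := by omega
        rw [pc_succ w, hN i hi]; ring
      | succ d ih =>
        intro j hjd
        have c := (loc i j hi (by omega)).cons r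
        have ih' := ih (j + 1) (by omega)
        rw [vv, vv] at ih'
        linarith
    exact key (N - j) j (by omega)
  have part := loc.part_bwd S
    (fun r i hi hr => by have := yam i r hi hr; linarith)
    (fun r j hj hr => by
      have := yam j r hj hr
      simp only [pc_congr (w := v N) (w' := w) (fun k hk => vN k (lt_of_lt_of_le hk le_rfl)),
        pc_congr (w := v N) (w' := w) (i := j) (fun k hk => vN k (lt_of_lt_of_le hk hj))]
      linarith) _ 0 0 (Nat.zero_le _) (Nat.zero_le _) le_rfl
  simp only [pc_zero, zero_sub, add_zero, neg_le_neg_iff] at part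
  have v0 : ∀ j, j < N → v 0 j = 0 := by
    intro j hj
    by_contra hc
    have up : ∀ k, pc (v 0) (v 0 j) N ≤ pc (v 0) (v 0 j + k) N := by
      intro k
      induction k with
      | zero => exact le_rfl
      | succ k ih => exact ih.trans (part _ (by omega))
    have big := up ((∑ k ∈ Finset.range N, v 0 k) + 1)
    have z : pc (v 0) (v 0 j + ((∑ k ∈ Finset.range N, v 0 k) + 1)) N = 0 := by
      apply Finset.sum_eq_zero
      intro k hk
      have := Finset.single_le_sum (f := fun k => v 0 k) (fun i _ => Nat.zero_le _) hk
      rw [if_neg]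
      omega
    rw [z] at big
    exact pc_eq_zero big j hj rfl
  have h0 : ∀ i, i < N → h i 0 = 0 := by
    intro i hi
    rw [(loc.bwd_unique loc.transpose e1 e2 _ i 0 hi.le (Nat.zero_le _) le_rfl).1 hi, v0 i hi]
  exact ⟨X, h, v, ⟨loc, h0, v0⟩, hN, Xs⟩

theorem wordOf_surj {N : ℕ} {w : ℕ → ℕ} (hw : GoodW N (rowsOf 0 0 0) w)
    (hal : ∀ i, i + 1 < N → (w (i + 1) ≤ w i ↔ Even i)) :
    ∃ π : Equiv.Perm (Fin N), (IsInvolution π ∧ IsAlternating π ∧ Avoids π p1234) ∧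
      wordOf π = w := by
  obtain ⟨X, h, v, G, hN, Xs⟩ := backward hw
  have ex : ∀ i : Fin N, ∃ j : Fin N, X i j := by
    intro i
    have : h i N ≠ 0 := by
      rw [hN i i.isLt]
      have := hw.1 i i.isLt
      omega
    obtain ⟨j, hj, hx⟩ := (G.loc.h_ne_zero G.h0 i N i.isLt le_rfl).1 this
    exact ⟨⟨j, hj⟩, hx⟩
  choose q hq using ex
  have uniq : ∀ i j : Fin N, X i j → q i = j := fun i j hx =>
    Fin.ext (G.loc.X_unique G.h0 i.isLt (Fin.isLt _) j.isLt (hq i) hx)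
  have inv : Function.Involutive q := fun i =>
    uniq _ _ ((Xs _ _ (Fin.isLt _) (Fin.isLt _)).1 (hq i))
  have hX : ∀ i j, i < N → j < N → (X i j ↔ Xof (inv.toPerm q) i j) := by
    intro i j hi hj
    constructor
    · intro hx
      exact ⟨⟨i, hi⟩, rfl, congrArg Fin.val (uniq ⟨i, hi⟩ ⟨j, hj⟩ hx)⟩
    · rintro ⟨k, rfl, rfl⟩
      exact hq k
  have G' : IsGrid N (Xof (inv.toPerm q)) h v := by
    refine ⟨fun i j hi hj => ?_, G.h0, G.v0⟩
    have := G.loc i j hi hj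
    rwa [hX i j hi hj] at this
  refine ⟨inv.toPerm q, ⟨inv, G'.alternating.2 ?_, G'.avoids.2 ?_⟩, ?_⟩
  · intro i hi
    rw [hN i (by omega), hN (i + 1) hi]
    exact hal i hi
  · have := hw.2.2.2
    rw [rowsOf_zero 1 le_rfl, zero_add] at this
    rwa [pc_congr (w' := w) (fun k hk => hN k hk)]
  · have K := g_isGrid (inv.toPerm q)
    funext i
    by_cases hi : i < N
    · rw [wordOf, if_pos hi, ← hN i hi]
      exact (K.loc.fwd_unique G'.loc (fun _ _ _ _ => Iff.rfl)
        (fun i hi => by rw [K.h0 i hi, G'.h0 i hi])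
        (fun i hi => by rw [K.v0 i hi, G'.v0 i hi]) _ i N hi.le le_rfl le_rfl).1 hi
    · rw [wordOf, if_neg hi, hw.2.1 i (by omega)]

theorem wordOf_mem {n : ℕ} (π : Equiv.Perm (Fin (2 * n)))
    (h : IsInvolution π ∧ IsAlternating π ∧ Avoids π p1234) : wordOf π ∈ VF n 0 0 0 := by
  rw [mem_VF n 0 0 0 _ le_rfl le_rfl]
  refine ⟨wordOf_good π h.2.2, fun i hi => ?_⟩
  rw [wordOf, wordOf, if_pos hi, if_pos (by omega)]
  exact (g_isGrid π).alternating.1 h.2.1 i hi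

/-- The number of alternating involutions of length 2n avoiding 1234 is the
n-th Motzkin number. -/
theorem card_AI_even_avoiding_1234 (M : ℕ → ℕ) (hM0 : M 0 = 1)
    (hMrec : ∀ n, M (n + 1) = M n + ∑ k ∈ Finset.range n, M k * M (n - 1 - k))
    (n : ℕ) :
    Nat.card {π : Equiv.Perm (Fin (2 * n)) //
      IsInvolution π ∧ IsAlternating π ∧ Avoids π p1234} = M n := by
  have hb : Function.Bijective (fun π : {π : Equiv.Perm (Fin (2 * n)) //
      IsInvolution π ∧ IsAlternating π ∧ Avoids π p1234} =>
      (⟨wordOf π.1, wordOf_mem π.1 π.2⟩ : {w // w ∈ VF n 0 0 0})) := by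
    constructor
    · intro π ρ h
      exact Subtype.ext (wordOf_inj π.2.1 ρ.2.1 (congrArg Subtype.val h))
    · rintro ⟨w, hw⟩
      obtain ⟨h1, h2⟩ := (mem_VF n 0 0 0 w le_rfl le_rfl).1 hw
      obtain ⟨π, hπ, e⟩ := wordOf_surj h1 h2
      exact ⟨⟨π, hπ⟩, Subtype.ext e⟩
  rw [Nat.card_eq_of_bijective _ hb, ← card_VF_motzkin M hM0 hMrec n]
  simp
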